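/- arXiv:1402.0298 — 4 statements merged into one kernel-verified Lean document; each statement's English description precedes it below -/
import Mathlib

section
/- For all real numbers ℓ > 0 and T > 0, ∫₀^T √(ℓT) · exp(ℓ/(2T) − ℓ/(2(T−t))) / √(2π · t · (T−t)³) dt = 1. Equivalently, ∫₀^T exp(−ℓ/(2(T−t))) · (t(T−t)³)^(−1/2) dt = √(2π/(ℓT)) · exp(−ℓ/(2T)). -/
open MeasureTheory Real

/-- The map `u ↦ T - T / (1 + u ^ 2)`, with inverse `t ↦ √(t / (T - t))`, sends `(0, ∞)` onto
`(0, T)`. -/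
lemma image_sub_div_one_add_sq_Ioi {T : ℝ} (hT : 0 < T) :
    (fun u : ℝ => T - T / (1 + u ^ 2)) '' Set.Ioi 0 = Set.Ioo 0 T := by
  ext t
  constructor
  · rintro ⟨u, hu, rfl⟩
    have hu : 0 < u := hu
    have h1 : T / (1 + u ^ 2) < T := div_lt_self hT (by nlinarith)
    have h2 : 0 < T / (1 + u ^ 2) := by positivity
    exact ⟨by linarith, by linarith⟩
  · rintro ⟨h0, h1⟩
    have hd : 0 < T - t := sub_pos.2 h1
    refine ⟨√(t / (T - t)), Real.sqrt_pos.2 (by positivity), ?_⟩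
    have h : 1 + t / (T - t) = T / (T - t) := by field_simp; ring
    simp only [Real.sq_sqrt (div_pos h0 hd).le, h]
    field_simp
    ring

lemma injOn_sub_div_one_add_sq_Ioi {T : ℝ} (hT : 0 < T) :
    Set.InjOn (fun u : ℝ => T - T / (1 + u ^ 2)) (Set.Ioi 0) := by
  intro u hu v hv h
  have hu : 0 < u := hu
  have hv : 0 < v := hv
  have h' : T / (1 + u ^ 2) = T / (1 + v ^ 2) := sub_right_injective h
  rw [div_eq_div_iff (by positivity) (by positivity)] at h'
  have h2 := mul_left_cancel₀ hT.ne' h'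
  exact (pow_left_inj₀ hu.le hv.le two_ne_zero).1 (by linarith)

lemma hasDerivAt_sub_div_one_add_sq (T u : ℝ) :
    HasDerivAt (fun u : ℝ => T - T / (1 + u ^ 2)) (2 * T * u / (1 + u ^ 2) ^ 2) u := by
  have h : HasDerivAt (fun u : ℝ => 1 + u ^ 2) (2 * u) u := by
    simpa using (hasDerivAt_pow 2 u).const_add 1
  refine (((hasDerivAt_const u T).div h (by positivity)).const_sub T).congr_deriv ?_
  field_simp
  ring

lemma integral_exp_neg_div_mul_inv_sqrt {ℓ T : ℝ} (hℓ : 0 < ℓ) (hT : 0 < T) :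
    (∫ t in Set.Ioo (0 : ℝ) T, exp (-ℓ / (2 * (T - t))) * (√(t * (T - t) ^ 3))⁻¹)
      = √(2 * π / (ℓ * T)) * exp (-ℓ / (2 * T)) := by
  rw [← image_sub_div_one_add_sq_Ioi hT,
    integral_image_eq_integral_abs_deriv_smul measurableSet_Ioi
      (fun u _ => (hasDerivAt_sub_div_one_add_sq T u).hasDerivWithinAt)
      (injOn_sub_div_one_add_sq_Ioi hT)]
  have hint : ∀ u ∈ Set.Ioi (0 : ℝ),
      |2 * T * u / (1 + u ^ 2) ^ 2| • (exp (-ℓ / (2 * (T - (T - T / (1 + u ^ 2))))) *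
        (√((T - T / (1 + u ^ 2)) * (T - (T - T / (1 + u ^ 2))) ^ 3))⁻¹)
      = 2 / T * exp (-ℓ / (2 * T)) * exp (-(ℓ / (2 * T)) * u ^ 2) := by
    intro u hu
    have hu : 0 < u := hu
    have hsq : (T - T / (1 + u ^ 2)) * (T - (T - T / (1 + u ^ 2))) ^ 3
        = (T ^ 2 * u / (1 + u ^ 2) ^ 2) ^ 2 := by
      field_simp
      ring
    have hexp : -ℓ / (2 * (T - (T - T / (1 + u ^ 2))))
        = -ℓ / (2 * T) + -(ℓ / (2 * T)) * u ^ 2 := by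
      rw [sub_sub_cancel]
      field_simp
      ring
    rw [hsq, hexp, Real.sqrt_sq (by positivity), abs_of_pos (by positivity), exp_add, smul_eq_mul]
    field_simp
  rw [setIntegral_congr_fun measurableSet_Ioi hint, integral_const_mul, integral_gaussian_Ioi]
  have hs : √(π / (ℓ / (2 * T))) = T * √(2 * π / (ℓ * T)) := by
    rw [show π / (ℓ / (2 * T)) = T ^ 2 * (2 * π / (ℓ * T)) by field_simp,
      Real.sqrt_mul (by positivity), Real.sqrt_sq hT.le]
  rw [hs]
  field_simp

/-- Equation `(Distribt2)` in the proof of Lemma `LemProbInt`: the density of the last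
zero before time `T` of a Brownian bridge of length `T` from `0` to `√ℓ` integrates to
`1` on `(0,T)`:
`∫₀^T √(ℓT) exp(ℓ/(2T) − ℓ/(2(T−t))) / √(2π t (T−t)³) dt = 1`, equivalently
`∫₀^T exp(−ℓ/(2(T−t))) (t(T−t)³)^(−1/2) dt = √(2π/(ℓT)) exp(−ℓ/(2T))`. -/
theorem integral_last_zero_density (ℓ T : ℝ) (hℓ : 0 < ℓ) (hT : 0 < T) :
    (∫ t in Set.Ioo (0 : ℝ) T,
        Real.sqrt (ℓ * T) * Real.exp (ℓ / (2 * T) - ℓ / (2 * (T - t)))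
          / Real.sqrt (2 * π * t * (T - t) ^ 3)) = 1 ∧
    (∫ t in Set.Ioo (0 : ℝ) T,
        Real.exp (-ℓ / (2 * (T - t))) * (t * (T - t) ^ 3) ^ (-(1 / 2) : ℝ))
      = Real.sqrt (2 * π / (ℓ * T)) * Real.exp (-ℓ / (2 * T)) := by
  have key := integral_exp_neg_div_mul_inv_sqrt hℓ hT
  constructor
  · have hfun : ∀ t ∈ Set.Ioo (0 : ℝ) T,
        √(ℓ * T) * exp (ℓ / (2 * T) - ℓ / (2 * (T - t))) / √(2 * π * t * (T - t) ^ 3)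
        = √(ℓ * T) * exp (ℓ / (2 * T)) / √(2 * π) *
          (exp (-ℓ / (2 * (T - t))) * (√(t * (T - t) ^ 3))⁻¹) := by
      intro t _
      rw [mul_assoc (2 * π), Real.sqrt_mul (x := 2 * π) (by positivity), sub_eq_add_neg, exp_add,
        neg_div, div_eq_mul_inv, div_eq_mul_inv, mul_inv]
      ring
    rw [setIntegral_congr_fun measurableSet_Ioo hfun, integral_const_mul, key,
      Real.sqrt_div (by positivity), neg_div, exp_neg]
    have h1 : 0 < √(ℓ * T) := by positivity
    have h2 : 0 < √(2 * π) := by positivity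
    field_simp
  · rw [← key]
    refine setIntegral_congr_fun measurableSet_Ioo fun t ht => ?_
    have hd : 0 < T - t := sub_pos.2 ht.2
    have h0 : 0 < t := ht.1
    rw [rpow_neg (by positivity), ← Real.sqrt_eq_rpow]
end

section
/- For all real numbers T > 0, ℓ₁ > 0 and ℓ₂ > 0, √(ℓ₂T/(2π)) · exp((ℓ₁+ℓ₂)/(2T)) · ∫₀^T exp(−ℓ₁/(2t) − ℓ₂/(2(T−t))) · (t(T−t)³)^(−1/2) dt = (1/√π) · ∫₀^∞ exp(−ℓ₁ℓ₂/((2T)²·s) − s) · s^(−1/2) ds. -/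
open MeasureTheory Real

/-- A positive dilation of `t ↦ t / (T - t)` maps `(0, T)` onto `(0, ∞)`. -/
lemma image_mul_div_sub_Ioo {T c : ℝ} (hT : 0 < T) (hc : 0 < c) :
    (fun t : ℝ => c * (t / (T - t))) '' Set.Ioo 0 T = Set.Ioi 0 := by
  ext s
  constructor
  · rintro ⟨t, ⟨ht0, htT⟩, rfl⟩
    have : 0 < T - t := sub_pos.2 htT
    exact Set.mem_Ioi.2 (by positivity)
  · intro hs
    have hs : 0 < s := hs
    have hcs : 0 < c + s := by positivity
    refine ⟨T * s / (c + s), ⟨by positivity, ?_⟩, ?_⟩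
    · rw [div_lt_iff₀ hcs]
      nlinarith [mul_pos hT hc]
    · have h : T - T * s / (c + s) = T * c / (c + s) := by
        field_simp
        ring
      simp only [h]
      field_simp

lemma injOn_mul_div_sub_Ioo {T c : ℝ} (hT : 0 < T) (hc : 0 < c) :
    Set.InjOn (fun t : ℝ => c * (t / (T - t))) (Set.Ioo 0 T) := by
  rintro x ⟨-, hx⟩ y ⟨-, hy⟩ hxy
  have hx' : T - x ≠ 0 := (sub_pos.2 hx).ne'
  have hy' : T - y ≠ 0 := (sub_pos.2 hy).ne'
  have h := (div_eq_div_iff hx' hy').1 (mul_left_cancel₀ hc.ne' hxy)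
  exact mul_left_cancel₀ hT.ne' (by linarith)

lemma hasDerivAt_mul_div_sub {T c t : ℝ} (ht : T - t ≠ 0) :
    HasDerivAt (fun t : ℝ => c * (t / (T - t))) (c * (T / (T - t) ^ 2)) t := by
  refine (((hasDerivAt_id' t).fun_div ((hasDerivAt_id' t).const_sub T) ht).const_mul
    c).congr_deriv ?_
  ring

/-- The algebraic prefactors match under the substitution `s = ℓ / (2 * T) * (t / (T - t))`. -/
lemma sqrt_mul_rpow_neg_half_eq {T ℓ t : ℝ} (hT : 0 < T) (hℓ : 0 < ℓ) (ht : 0 < t)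
    (htT : t < T) :
    Real.sqrt (ℓ * T / (2 * π)) * (t * (T - t) ^ 3) ^ (-(1 / 2) : ℝ)
      = 1 / Real.sqrt π * (ℓ / (2 * T) * (T / (T - t) ^ 2)
        * (ℓ / (2 * T) * (t / (T - t))) ^ (-(1 / 2) : ℝ)) := by
  have hu : 0 < T - t := sub_pos.2 htT
  have hπ := Real.pi_pos
  rw [Real.rpow_neg (by positivity), Real.rpow_neg (by positivity), ← Real.sqrt_eq_rpow,
    ← Real.sqrt_eq_rpow]
  refine (sq_eq_sq₀ (by positivity) (by positivity)).1 ?_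
  simp only [mul_pow, inv_pow, div_pow, one_pow]
  rw [Real.sq_sqrt (by positivity), Real.sq_sqrt (by positivity), Real.sq_sqrt (by positivity),
    Real.sq_sqrt (by positivity)]
  field_simp

/-- The exponents match under the substitution `s = ℓ₂ / (2 * T) * (t / (T - t))`. -/
lemma exponent_eq {T ℓ₁ ℓ₂ t : ℝ} (hT : T ≠ 0) (h₂ : ℓ₂ ≠ 0) (ht : t ≠ 0) (hu : T - t ≠ 0) :
    (ℓ₁ + ℓ₂) / (2 * T) + (-ℓ₁ / (2 * t) - ℓ₂ / (2 * (T - t)))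
      = -(ℓ₁ * ℓ₂) / ((2 * T) ^ 2 * (ℓ₂ / (2 * T) * (t / (T - t))))
        - ℓ₂ / (2 * T) * (t / (T - t)) := by
  field_simp
  ring

/-- Change of variables `s = (ℓ₂/(2T)) t/(T−t)` in the proof of Lemma `LemProbInt`:
`√(ℓ₂T/(2π)) exp((ℓ₁+ℓ₂)/(2T)) ∫₀^T exp(−ℓ₁/(2t) − ℓ₂/(2(T−t))) (t(T−t)³)^(−1/2) dt
  = (1/√π) ∫₀^∞ exp(−ℓ₁ℓ₂/((2T)²s) − s) s^(−1/2) ds`. -/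
theorem integral_change_of_variables_LemProbInt (T ℓ₁ ℓ₂ : ℝ)
    (hT : 0 < T) (h₁ : 0 < ℓ₁) (h₂ : 0 < ℓ₂) :
    Real.sqrt (ℓ₂ * T / (2 * π)) * Real.exp ((ℓ₁ + ℓ₂) / (2 * T)) *
      ∫ t in Set.Ioo (0 : ℝ) T,
        Real.exp (-ℓ₁ / (2 * t) - ℓ₂ / (2 * (T - t)))
          * (t * (T - t) ^ 3) ^ (-(1 / 2) : ℝ)
    = (1 / Real.sqrt π) *
      ∫ s in Set.Ioi (0 : ℝ),
        Real.exp (-(ℓ₁ * ℓ₂) / ((2 * T) ^ 2 * s) - s) * s ^ (-(1 / 2) : ℝ) := by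
  have hc : 0 < ℓ₂ / (2 * T) := by positivity
  rw [← image_mul_div_sub_Ioo hT hc,
    integral_image_eq_integral_abs_deriv_smul measurableSet_Ioo
      (fun t ht => (hasDerivAt_mul_div_sub (sub_pos.2 ht.2).ne').hasDerivWithinAt)
      (injOn_mul_div_sub_Ioo hT hc),
    ← integral_const_mul, ← integral_const_mul]
  refine setIntegral_congr_fun measurableSet_Ioo fun t ht => ?_
  have hu : 0 < T - t := sub_pos.2 ht.2
  have hexp := congrArg Real.exp (exponent_eq (ℓ₁ := ℓ₁) hT.ne' h₂.ne' ht.1.ne' hu.ne')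
  rw [Real.exp_add] at hexp
  have hpre := sqrt_mul_rpow_neg_half_eq hT h₂ ht.1 ht.2
  simp only [smul_eq_mul]
  rw [abs_of_pos (by positivity), ← hexp]
  linear_combination (Real.exp ((ℓ₁ + ℓ₂) / (2 * T)) *
    Real.exp (-ℓ₁ / (2 * t) - ℓ₂ / (2 * (T - t)))) * hpre
end

section
/- For all real numbers T > 0, ℓ₁ > 0 and ℓ₂ > 0, ∫₀^T exp(−ℓ₁/(2t) − ℓ₂/(2(T−t))) · (t(T−t)³)^(−1/2) dt = √(2π/(ℓ₂T)) · exp(−(ℓ₁+ℓ₂)/(2T) − √(ℓ₁ℓ₂)/T). -/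
open MeasureTheory Real

/-- The Cauchy–Schlömilch substitution for the Gaussian integral. -/
theorem integral_Ioi_exp_neg_sq_sub_div {a b : ℝ} (ha : 0 < a) (hb : 0 < b) :
    ∫ u in Set.Ioi (0 : ℝ), exp (-(a * u - b / u) ^ 2) = √π / (2 * a) := by
  have hpos (s : ℝ) : 0 < s ^ 2 + 4 * a * b := by positivity
  have hroot (s : ℝ) : 0 < s + √(s ^ 2 + 4 * a * b) := by
    have : |s| < √(s ^ 2 + 4 * a * b) := by
      rw [← sqrt_sq_eq_abs]
      exact sqrt_lt_sqrt (sq_nonneg s) (by nlinarith [mul_pos ha hb])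
    linarith [neg_abs_le s]
  set f : ℝ → ℝ := fun s => (s + √(s ^ 2 + 4 * a * b)) / (2 * a) with hf
  have hf_pos (s : ℝ) : 0 < f s := div_pos (hroot s) (by positivity)
  have hf_left (s : ℝ) : a * f s - b / f s = s := by
    have h := (hroot s).ne'
    have hsq := sq_sqrt (hpos s).le
    simp only [hf]
    generalize √(s ^ 2 + 4 * a * b) = r at h hsq
    field_simp
    linear_combination hsq
  have hf_right {u : ℝ} (hu : 0 < u) : f (a * u - b / u) = u := by
    have hsq : (a * u - b / u) ^ 2 + 4 * a * b = (a * u + b / u) ^ 2 := by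
      field_simp
      ring
    simp only [hf]
    rw [hsq, sqrt_sq (by positivity)]
    field_simp
    ring
  have himage : f '' Set.univ = Set.Ioi 0 := by
    ext u
    exact ⟨fun ⟨s, _, hs⟩ => hs ▸ hf_pos s, fun hu => ⟨_, trivial, hf_right hu⟩⟩
  have hderiv (s : ℝ) : HasDerivAt f ((1 + s / √(s ^ 2 + 4 * a * b)) / (2 * a)) s := by
    have h := ((hasDerivAt_id s).add ((((hasDerivAt_id s).pow 2).add_const (4 * a * b)).sqrt
      (hpos s).ne')).div_const (2 * a)
    refine HasDerivAt.congr_deriv (f := f) h ?_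
    simp only [id, Pi.pow_apply, Nat.cast_ofNat]
    field_simp
    norm_num
  have hderiv_nonneg (s : ℝ) : 0 ≤ (1 + s / √(s ^ 2 + 4 * a * b)) / (2 * a) := by
    have hr := sqrt_pos.2 (hpos s)
    have : 1 + s / √(s ^ 2 + 4 * a * b) =
        (s + √(s ^ 2 + 4 * a * b)) / √(s ^ 2 + 4 * a * b) := by
      field_simp
      ring
    rw [this]
    have := hroot s
    positivity
  have hinj : Function.Injective f := Function.LeftInverse.injective
    (g := fun u => a * u - b / u) hf_left
  have hgauss : Integrable (fun s : ℝ => exp (-s ^ 2)) := by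
    simpa using integrable_exp_neg_mul_sq one_pos
  have hgauss_eq : ∫ s : ℝ, exp (-s ^ 2) = √π := by
    simpa using integral_gaussian 1
  have hodd : ∫ s : ℝ, exp (-s ^ 2) * (s / √(s ^ 2 + 4 * a * b)) = 0 := by
    have h := integral_neg_eq_self (fun s : ℝ => exp (-s ^ 2) * (s / √(s ^ 2 + 4 * a * b))) volume
    simp only [neg_sq, neg_div, mul_neg, integral_neg] at h
    linarith
  have hodd_int : Integrable fun s : ℝ => exp (-s ^ 2) * (s / √(s ^ 2 + 4 * a * b)) := by
    refine hgauss.mul_bdd (c := 1)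
      (Measurable.aestronglyMeasurable (by fun_prop)) (Filter.Eventually.of_forall fun s => ?_)
    rw [norm_div, norm_eq_abs, norm_of_nonneg (sqrt_nonneg _), ← sqrt_sq_eq_abs]
    exact div_le_one_of_le₀ (sqrt_le_sqrt (by nlinarith [mul_pos ha hb])) (sqrt_nonneg _)
  rw [← himage, integral_image_eq_integral_abs_deriv_smul MeasurableSet.univ
    (fun s _ => (hderiv s).hasDerivWithinAt) hinj.injOn, setIntegral_univ]
  calc _ = ∫ s : ℝ, (exp (-s ^ 2) + exp (-s ^ 2) * (s / √(s ^ 2 + 4 * a * b))) / (2 * a) := by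
        refine integral_congr_ae (Filter.Eventually.of_forall fun s => ?_)
        simp only [smul_eq_mul]
        rw [hf_left, abs_of_nonneg (hderiv_nonneg s)]
        ring
    _ = _ := by
        rw [integral_div, integral_add hgauss hodd_int, hodd, hgauss_eq, add_zero]

/-- Parametrise `t ∈ (0, T)` by `u = √(t / (T - t)) ∈ (0, ∞)`. -/
theorem integral_Ioo_eq_integral_Ioi_sq_div {T : ℝ} (hT : 0 < T) (g : ℝ → ℝ) :
    ∫ t in Set.Ioo 0 T, g t =
      ∫ u in Set.Ioi (0 : ℝ), 2 * T * u / (1 + u ^ 2) ^ 2 * g (T * u ^ 2 / (1 + u ^ 2)) := by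
  set f : ℝ → ℝ := fun u => T * u ^ 2 / (1 + u ^ 2) with hf
  have hone (u : ℝ) : 0 < 1 + u ^ 2 := by positivity
  have hf_left {u : ℝ} (hu : 0 < u) : √(f u / (T - f u)) = u := by
    have h : f u / (T - f u) = u ^ 2 := by
      have hsub : T - f u = T / (1 + u ^ 2) := by
        simp only [hf]
        field_simp
        ring
      rw [hsub]
      simp only [hf]
      field_simp
    rw [h, sqrt_sq hu.le]
  have hinj : Set.InjOn f (Set.Ioi 0) := fun u hu v hv huv => by
    rw [← hf_left hu, ← hf_left hv, huv]
  have himage : f '' Set.Ioi 0 = Set.Ioo 0 T := by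
    ext t
    constructor
    · rintro ⟨u, hu, rfl⟩
      have hu : 0 < u := hu
      exact ⟨by positivity, (div_lt_iff₀ (hone u)).2 (by nlinarith)⟩
    · rintro ⟨h0, hlt⟩
      have hsub : 0 < T - t := sub_pos.2 hlt
      refine ⟨√(t / (T - t)), sqrt_pos.2 (div_pos h0 hsub), ?_⟩
      simp only [hf]
      rw [sq_sqrt (div_pos h0 hsub).le]
      field_simp
      ring
  have hderiv (u : ℝ) : HasDerivAt f (2 * T * u / (1 + u ^ 2) ^ 2) u := by
    have h := (((hasDerivAt_id u).pow 2).const_mul T).div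
      (((hasDerivAt_id u).pow 2).const_add 1) (hone u).ne'
    refine HasDerivAt.congr_deriv (f := f) h ?_
    simp only [id, Pi.pow_apply, Nat.cast_ofNat]
    field_simp
    norm_num
  rw [← himage, integral_image_eq_integral_abs_deriv_smul measurableSet_Ioi
    (fun u _ => (hderiv u).hasDerivWithinAt) hinj]
  refine setIntegral_congr_fun measurableSet_Ioi fun u hu => ?_
  have hu : 0 < u := hu
  simp only [smul_eq_mul]
  rw [abs_of_nonneg (by positivity)]

/-- Closed form combining Lemmas `LemProbInt` and `LemIntegral` of the paper:
`∫₀^T exp(−ℓ₁/(2t) − ℓ₂/(2(T−t))) (t(T−t)³)^(−1/2) dt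
  = √(2π/(ℓ₂T)) exp(−(ℓ₁+ℓ₂)/(2T) − √(ℓ₁ℓ₂)/T)`. -/
theorem integral_closed_form_CorProbAbsEdge (T ℓ₁ ℓ₂ : ℝ)
    (hT : 0 < T) (h₁ : 0 < ℓ₁) (h₂ : 0 < ℓ₂) :
    (∫ t in Set.Ioo (0 : ℝ) T,
        Real.exp (-ℓ₁ / (2 * t) - ℓ₂ / (2 * (T - t)))
          * (t * (T - t) ^ 3) ^ (-(1 / 2) : ℝ))
      = Real.sqrt (2 * π / (ℓ₂ * T)) *
          Real.exp (-(ℓ₁ + ℓ₂) / (2 * T) - Real.sqrt (ℓ₁ * ℓ₂) / T) := by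
  rw [integral_Ioo_eq_integral_Ioi_sq_div hT]
  set a := √(ℓ₂ / (2 * T)) with ha_def
  set b := √(ℓ₁ / (2 * T)) with hb_def
  have ha : 0 < a := sqrt_pos.2 (by positivity)
  have hb : 0 < b := sqrt_pos.2 (by positivity)
  have ha2 : a ^ 2 = ℓ₂ / (2 * T) := sq_sqrt (by positivity)
  have hb2 : b ^ 2 = ℓ₁ / (2 * T) := sq_sqrt (by positivity)
  have hab : 2 * a * b = √(ℓ₁ * ℓ₂) / T := by
    rw [mul_assoc, ha_def, hb_def, ← sqrt_mul (by positivity),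
      show ℓ₂ / (2 * T) * (ℓ₁ / (2 * T)) = ℓ₁ * ℓ₂ / (2 * T) ^ 2 by field_simp,
      sqrt_div (by positivity), sqrt_sq (by positivity)]
    field_simp
  have hconst : 2 / T * (√π / (2 * a)) = √(2 * π / (ℓ₂ * T)) := by
    symm
    rw [sqrt_eq_iff_mul_self_eq_of_pos (by positivity)]
    calc _ = π / (T ^ 2 * a ^ 2) := by
          field_simp
          rw [sq_sqrt pi_pos.le]
      _ = _ := by
          rw [ha2]
          field_simp
  have hintegrand : ∀ u ∈ Set.Ioi (0 : ℝ),
      2 * T * u / (1 + u ^ 2) ^ 2 *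
        (exp (-ℓ₁ / (2 * (T * u ^ 2 / (1 + u ^ 2))) -
            ℓ₂ / (2 * (T - T * u ^ 2 / (1 + u ^ 2)))) *
          (T * u ^ 2 / (1 + u ^ 2) * (T - T * u ^ 2 / (1 + u ^ 2)) ^ 3) ^ (-(1 / 2) : ℝ)) =
      2 / T * exp (-(ℓ₁ + ℓ₂) / (2 * T) - √(ℓ₁ * ℓ₂) / T) * exp (-(a * u - b / u) ^ 2) := by
    intro u hu
    have hu : 0 < u := hu
    have hsub : T - T * u ^ 2 / (1 + u ^ 2) = T / (1 + u ^ 2) := by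
      field_simp
      ring
    have hpow : (T * u ^ 2 / (1 + u ^ 2) * (T / (1 + u ^ 2)) ^ 3) ^ (-(1 / 2) : ℝ) =
        (T ^ 2 * u / (1 + u ^ 2) ^ 2)⁻¹ := by
      rw [rpow_neg (by positivity), ← sqrt_eq_rpow,
        show T * u ^ 2 / (1 + u ^ 2) * (T / (1 + u ^ 2)) ^ 3 =
          (T ^ 2 * u / (1 + u ^ 2) ^ 2) ^ 2 by field_simp, sqrt_sq (by positivity)]
    have hexp : -ℓ₁ / (2 * (T * u ^ 2 / (1 + u ^ 2))) - ℓ₂ / (2 * (T / (1 + u ^ 2))) =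
        (-(ℓ₁ + ℓ₂) / (2 * T) - √(ℓ₁ * ℓ₂) / T) + -(a * u - b / u) ^ 2 := by
      have hsq : (a * u - b / u) ^ 2 = a ^ 2 * u ^ 2 - 2 * a * b + b ^ 2 / u ^ 2 := by
        field_simp
        ring
      rw [hsq, ha2, hb2, hab]
      field_simp
      ring
    rw [hsub, hpow, hexp, exp_add]
    field_simp
  rw [setIntegral_congr_fun measurableSet_Ioi hintegrand, integral_const_mul,
    integral_Ioi_exp_neg_sq_sub_div ha hb, ← hconst]
  ring
end

section
/- Let Z₁ and Z₂ be independent standard Gaussian random variables, i.e. the underlying probability measure is μ = (gaussianReal 0 1) × (gaussianReal 0 1) on ℝ², and let g be a real number with −1 ≤ g ≤ 1. Then ∫ sign(z₁) · sign(g·z₁ + √(1−g²)·z₂) dμ(z₁,z₂) = (2/π) · arcsin(g). -/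
open MeasureTheory ProbabilityTheory Real

theorem Real.measurable_sign : Measurable Real.sign :=
  Measurable.ite measurableSet_Iio measurable_const
    (Measurable.ite measurableSet_Ioi measurable_const measurable_const)

theorem Real.abs_sign_le_one (x : ℝ) : |Real.sign x| ≤ 1 := by
  rcases Real.sign_apply_eq x with h | h | h <;> simp [h]

theorem Real.sign_mul_of_pos {r : ℝ} (hr : 0 < r) (x : ℝ) :
    Real.sign (r * x) = Real.sign x := by
  rcases lt_trichotomy x 0 with hx | rfl | hx
  · rw [Real.sign_of_neg hx, Real.sign_of_neg (mul_neg_of_pos_of_neg hr hx)]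
  · simp
  · rw [Real.sign_of_pos hx, Real.sign_of_pos (mul_pos hr hx)]

theorem intervalIntegrable_of_measurable_of_abs_le {f : ℝ → ℝ} (hf : Measurable f) {C : ℝ}
    (hC : ∀ x, |f x| ≤ C) (a b : ℝ) : IntervalIntegrable f volume a b :=
  (intervalIntegrable_const (c := C)).mono_fun hf.aestronglyMeasurable
    (Filter.Eventually.of_forall fun x => (hC x).trans (le_abs_self C))

theorem integral_sign_sin {a b : ℝ} (ha : -π ≤ a) (ha' : a ≤ 0) (hb : 0 ≤ b) (hb' : b ≤ π) :
    ∫ u in a..b, Real.sign (sin u) = a + b := by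
  have hint : ∀ s t, IntervalIntegrable (fun u => Real.sign (sin u)) volume s t :=
    intervalIntegrable_of_measurable_of_abs_le (Real.measurable_sign.comp measurable_sin)
      fun x => Real.abs_sign_le_one _
  rw [← intervalIntegral.integral_add_adjacent_intervals (hint a 0) (hint 0 b),
    intervalIntegral.integral_congr_Ioo_of_le (g := fun _ => (-1 : ℝ)) ha'
      fun u hu => Real.sign_of_neg
        (sin_neg_of_neg_of_neg_pi_lt hu.2 (ha.trans_lt hu.1)),
    intervalIntegral.integral_congr_Ioo_of_le (g := fun _ => (1 : ℝ)) hb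
      fun u hu => Real.sign_of_pos (sin_pos_of_pos_of_lt_pi hu.1 (hu.2.trans_le hb'))]
  simp

theorem integral_sign_cos_mul_sign_sin_add {α : ℝ} (h₁ : -(π / 2) ≤ α) (h₂ : α ≤ π / 2) :
    ∫ θ in (-π)..π, Real.sign (cos θ) * Real.sign (sin (θ + α)) = 4 * α := by
  set f : ℝ → ℝ := fun θ => Real.sign (cos θ) * Real.sign (sin (θ + α)) with hf
  have hper : Function.Periodic f π := fun θ => by
    simp only [hf, cos_add_pi, add_right_comm θ π α, sin_add_pi, Real.sign_neg, neg_mul_neg]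
  have hint : ∀ s t, IntervalIntegrable f volume s t := by
    refine intervalIntegrable_of_measurable_of_abs_le (C := 1) ?_ fun x => ?_
    · exact (Real.measurable_sign.comp measurable_cos).mul
        (Real.measurable_sign.comp (measurable_sin.comp (measurable_id.add_const α)))
    · rw [abs_mul]
      exact mul_le_one₀ (Real.abs_sign_le_one _) (abs_nonneg _) (Real.abs_sign_le_one _)
  have hhalf : ∫ θ in (-(π / 2))..(-(π / 2) + π), f θ = 2 * α := by
    rw [show -(π / 2) + π = π / 2 by ring,
      intervalIntegral.integral_congr_Ioo_of_le (g := fun θ => Real.sign (sin (θ + α)))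
        (by linarith [pi_pos]) fun θ hθ => by
          simp only [hf, Real.sign_of_pos (cos_pos_of_mem_Ioo hθ), one_mul],
      intervalIntegral.integral_comp_add_right (fun u => Real.sign (sin u)),
      integral_sign_sin (by linarith) (by linarith) (by linarith) (by linarith)]
    ring
  have hleft := hper.intervalIntegral_add_eq (-π) (-(π / 2))
  have hright := hper.intervalIntegral_add_eq 0 (-(π / 2))
  rw [neg_add_cancel] at hleft
  rw [zero_add] at hright
  rw [← intervalIntegral.integral_add_adjacent_intervals (hint (-π) 0) (hint 0 π), hleft, hright,
    hhalf]
  ring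

theorem integral_mul_exp_neg_sq_div_two :
    ∫ r in Set.Ioi (0 : ℝ), r * exp (-r ^ 2 / 2) = 1 := by
  have h := integral_rpow_mul_exp_neg_mul_rpow (p := 2) (q := 1) (b := 1 / 2)
    (by norm_num) (by norm_num) (by norm_num)
  norm_num [rpow_neg_one] at h
  rw [← h]
  refine setIntegral_congr_fun measurableSet_Ioi fun r _ => ?_
  congr 2
  ring

theorem integral_gaussianReal_prod_eq_integral_polar (F : ℝ × ℝ → ℝ) :
    ∫ p, F p ∂((gaussianReal 0 1).prod (gaussianReal 0 1)) =
      ∫ p in Set.Ioi (0 : ℝ) ×ˢ Set.Ioo (-π) π,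
        p.1 * ((2 * π)⁻¹ * exp (-p.1 ^ 2 / 2) * F (p.1 * cos p.2, p.1 * sin p.2)) := by
  rw [gaussianReal_of_var_ne_zero 0 one_ne_zero,
    prod_withDensity (measurable_gaussianPDF 0 1) (measurable_gaussianPDF 0 1),
    integral_withDensity_eq_integral_toReal_smul
      (by have := measurable_gaussianPDF 0 1; fun_prop)
      (Filter.Eventually.of_forall fun p =>
        ENNReal.mul_lt_top gaussianPDF_lt_top gaussianPDF_lt_top),
    ← Measure.volume_eq_prod, ← integral_comp_polarCoord_symm]
  refine setIntegral_congr_fun polarCoord.open_target.measurableSet fun p _ => ?_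
  have hsqrt : (√(2 * π))⁻¹ * (√(2 * π))⁻¹ = (2 * π)⁻¹ := by
    rw [← mul_inv, mul_self_sqrt (by positivity)]
  have hexp : exp (-(p.1 * cos p.2) ^ 2 / 2) * exp (-(p.1 * sin p.2) ^ 2 / 2) =
      exp (-p.1 ^ 2 / 2) := by
    rw [← exp_add]
    congr 1
    linear_combination (-p.1 ^ 2 / 2) * sin_sq_add_cos_sq p.2
  simp only [polarCoord_symm_apply, smul_eq_mul, ENNReal.toReal_mul, toReal_gaussianPDF,
    gaussianPDFReal, NNReal.coe_one, mul_one, sub_zero]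
  rw [← hsqrt, ← hexp]
  ring

/-- The arcsine formula for the correlation of signs of a centered Gaussian vector with
unit variances and correlation `g` (proof of Proposition `PropMajClust`):
`E[sign(Z₁) · sign(g Z₁ + √(1−g²) Z₂)] = (2/π) arcsin g`. -/
theorem integral_sign_mul_sign_gaussian (g : ℝ) (hg₁ : -1 ≤ g) (hg₂ : g ≤ 1) :
    ∫ p : ℝ × ℝ,
        Real.sign p.1 * Real.sign (g * p.1 + Real.sqrt (1 - g ^ 2) * p.2)
        ∂((gaussianReal 0 1).prod (gaussianReal 0 1))
      = 2 / π * Real.arcsin g := by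
  rw [integral_gaussianReal_prod_eq_integral_polar]
  have hcongr : Set.EqOn
      (fun p : ℝ × ℝ => p.1 * ((2 * π)⁻¹ * exp (-p.1 ^ 2 / 2) *
        (Real.sign (p.1 * cos p.2) *
          Real.sign (g * (p.1 * cos p.2) + √(1 - g ^ 2) * (p.1 * sin p.2)))))
      (fun p => (p.1 * exp (-p.1 ^ 2 / 2)) *
        ((2 * π)⁻¹ * (Real.sign (cos p.2) * Real.sign (sin (p.2 + arcsin g)))))
      (Set.Ioi (0 : ℝ) ×ˢ Set.Ioo (-π) π) := by
    intro p hp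
    have hsin : g * (p.1 * cos p.2) + √(1 - g ^ 2) * (p.1 * sin p.2) =
        p.1 * sin (p.2 + arcsin g) := by
      rw [sin_add, sin_arcsin hg₁ hg₂, cos_arcsin]
      ring
    simp only [hsin, Real.sign_mul_of_pos hp.1]
    ring
  rw [setIntegral_congr_fun (measurableSet_Ioi.prod measurableSet_Ioo) hcongr,
    Measure.volume_eq_prod,
    setIntegral_prod_mul (fun r : ℝ => r * exp (-r ^ 2 / 2))
      (fun θ : ℝ => (2 * π)⁻¹ * (Real.sign (cos θ) * Real.sign (sin (θ + arcsin g)))),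
    integral_mul_exp_neg_sq_div_two, integral_const_mul, ← integral_Ioc_eq_integral_Ioo,
    ← intervalIntegral.integral_of_le (by linarith [pi_pos]),
    integral_sign_cos_mul_sign_sin_add (neg_pi_div_two_le_arcsin g) (arcsin_le_pi_div_two g)]
  field_simp
  ring
end
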